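/- Let σ, B, C, τ_Q, c_δ be positive constants and let ε > 0 be sufficiently small. There exists n_0 (depending only on these parameters) such that for all n ≥ n_0 the following holds. Let G be a graph on [n] with degree sequence g, let d be a positive integer sequence with even sum, and let β ∈ ℝ^n, such that (G, d, β) satisfies Assumptions (a)–(e). Then for every edge jk of G: e^{−3C} λ ≤ λ_{jk} ≤ e^{3C} λ; e^{−3C}(1−λ) ≤ 1−λ_{jk} ≤ e^{3C}(1−λ); and e^{−6C} Λ ≤ λ_{jk}(1−λ_{jk}) ≤ e^{6C} Λ. -/

import Mathlib

open scoped BigOperators Classical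

noncomputable section

/-- The degree `g_j` of vertex `j` in `G`. -/
def degS {n : ℕ} (G : SimpleGraph (Fin n)) (j : Fin n) : ℕ := (G.neighborSet j).ncard

/-- `λ_{jk}(β) = e^{β_j+β_k}/(1+e^{β_j+β_k})`. -/
def lamE {n : ℕ} (β : Fin n → ℝ) (j k : Fin n) : ℝ :=
  Real.exp (β j + β k) / (1 + Real.exp (β j + β k))

/-- `δ_j = Σ_{k : jk∈E(G)} λ_{jk} − d_j`. -/
def deltaV {n : ℕ} (G : SimpleGraph (Fin n)) (β : Fin n → ℝ) (d : Fin n → ℕ) (j : Fin n) : ℝ :=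
  (∑ k, if G.Adj j k then lamE β j k else 0) - (d j : ℝ)

/-- `λ = (Σ_j d_j)/(Σ_j g_j)`. -/
def lamAvg {n : ℕ} (G : SimpleGraph (Fin n)) (d : Fin n → ℕ) : ℝ :=
  (∑ j, (d j : ℝ)) / ∑ j, (degS G j : ℝ)

/-- `Λ = λ(1−λ)`. -/
def LamV {n : ℕ} (G : SimpleGraph (Fin n)) (d : Fin n → ℕ) : ℝ :=
  lamAvg G d * (1 - lamAvg G d)

/-- The number of edges of `G` with exactly one end in `U`. -/
def edgeBoundaryCard {n : ℕ} (G : SimpleGraph (Fin n)) (U : Finset (Fin n)) : ℕ :=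
  (Finset.univ.filter fun p : Fin n × Fin n => G.Adj p.1 p.2 ∧ p.1 ∈ U ∧ p.2 ∉ U).card

/-- `h(G) ≥ x`: lower bound on the Cheeger (isoperimetric) constant of `G`. -/
def CheegerLB {n : ℕ} (G : SimpleGraph (Fin n)) (x : ℝ) : Prop :=
  ∀ U : Finset (Fin n), U.Nonempty → (U.card : ℝ) ≤ (n : ℝ) / 2 →
    x * (U.card : ℝ) ≤ (edgeBoundaryCard G U : ℝ)

/-- `q(G) ≥ x`: lower bound on the least eigenvalue of the signless Laplacian, expressed via
its quadratic form `Σ_{jk∈E(G)}(θ_j+θ_k)² ≥ x Σ_j θ_j²`. -/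
def SignlessLapLB {n : ℕ} (G : SimpleGraph (Fin n)) (x : ℝ) : Prop :=
  ∀ θ : Fin n → ℝ,
    x * ∑ j, (θ j) ^ 2 ≤ (1 / 2) * ∑ j, ∑ k, if G.Adj j k then (θ j + θ k) ^ 2 else 0

/-- Assumptions (a)–(e) of the paper for the data `(G, d, β)` and
constants `σ, B, C, τ_Q, c_δ` and `ε`. -/
def Assumptions {n : ℕ} (G : SimpleGraph (Fin n)) (d : Fin n → ℕ) (β : Fin n → ℝ)
    (σv B C τQ cδ ε : ℝ) : Prop :=
  (∀ j, d j ≤ degS G j) ∧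
  (∀ j k, |β j - β k| ≤ C) ∧
  (B * (n : ℝ) ^ (σv - 1) ≤ LamV G d) ∧
  CheegerLB G ((LamV G d)⁻¹ * (Real.log n) ^ 2) ∧
  SignlessLapLB G (τQ * (n : ℝ)) ∧
  (∀ j, |deltaV G β d j| ≤ cδ * (LamV G d) ^ ((1 : ℝ) / 2) * (n : ℝ) ^ ((1 : ℝ) / 2 - σv / 2)) ∧
  ((∑ j, |deltaV G β d j|) ≤ cδ * (n : ℝ) ^ (1 + ε))

/-- Shifting the argument by at most `c` changes the logistic function by a factor at most `e^c`. -/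
lemma logistic_le_exp_mul {x y c : ℝ} (hc : 0 ≤ c) (h : x ≤ y + c) :
    Real.exp x / (1 + Real.exp x) ≤ Real.exp c * (Real.exp y / (1 + Real.exp y)) := by
  have hx := Real.exp_pos x
  have hy := Real.exp_pos y
  have h1 : 1 ≤ Real.exp c := Real.one_le_exp hc
  have h2 : Real.exp x ≤ Real.exp c * Real.exp y := by
    rw [← Real.exp_add]
    exact Real.exp_le_exp.mpr (by linarith)
  rw [← mul_div_assoc, div_le_div_iff₀ (by positivity) (by positivity)]
  nlinarith [mul_le_mul_of_nonneg_right h1 (mul_pos hx hy).le]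

lemma one_sub_logistic (x : ℝ) :
    1 - Real.exp x / (1 + Real.exp x) = Real.exp (-x) / (1 + Real.exp (-x)) := by
  have hx := Real.exp_pos x
  rw [Real.exp_neg]
  field_simp
  ring

lemma one_sub_logistic_le_exp_mul {x y c : ℝ} (hc : 0 ≤ c) (h : y ≤ x + c) :
    1 - Real.exp x / (1 + Real.exp x) ≤ Real.exp c * (1 - Real.exp y / (1 + Real.exp y)) := by
  rw [one_sub_logistic, one_sub_logistic]
  exact logistic_le_exp_mul hc (by linarith)

lemma degS_eq_sum {n : ℕ} (G : SimpleGraph (Fin n)) (j : Fin n) :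
    (degS G j : ℝ) = ∑ k, if G.Adj j k then 1 else 0 := by
  rw [degS, Set.ncard_eq_toFinset_card']
  simp [Finset.sum_boole]

/-- A lower bound on the least eigenvalue of the signless Laplacian bounds the degree sum. -/
lemma SignlessLapLB.mul_le_sum_degS {n : ℕ} {G : SimpleGraph (Fin n)} {x : ℝ}
    (h : SignlessLapLB G x) : x * n ≤ 2 * ∑ j, (degS G j : ℝ) := by
  have h1 := h fun _ => 1
  have h2 : (∑ j, ∑ k, if G.Adj j k then ((1 : ℝ) + 1) ^ 2 else 0)
      = 4 * ∑ j, (degS G j : ℝ) := by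
    simp_rw [degS_eq_sum, Finset.mul_sum]
    refine Finset.sum_congr rfl fun j _ => Finset.sum_congr rfl fun k _ => ?_
    split_ifs <;> norm_num
  simp only [h2] at h1
  simp at h1
  linarith

lemma sum_deltaV {n : ℕ} (G : SimpleGraph (Fin n)) (β : Fin n → ℝ) (d : Fin n → ℕ) :
    ∑ j, deltaV G β d j
      = (∑ j, ∑ k, if G.Adj j k then lamE β j k else 0) - ∑ j, (d j : ℝ) := by
  simp [deltaV, Finset.sum_sub_distrib]

/-- Summing an edgewise inequality over all adjacent ordered pairs. -/
lemma mul_sum_degS_le {n : ℕ} (G : SimpleGraph (Fin n)) (f : Fin n → Fin n → ℝ) (a b : ℝ)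
    (h : ∀ j k, G.Adj j k → a ≤ b * f j k) :
    a * ∑ j, (degS G j : ℝ) ≤ b * ∑ j, ∑ k, if G.Adj j k then f j k else 0 := by
  simp_rw [degS_eq_sum, Finset.mul_sum]
  refine Finset.sum_le_sum fun j _ => Finset.sum_le_sum fun k _ => ?_
  split_ifs with hjk
  · simpa using h j k hjk
  · simp

lemma sum_one_sub_lamE {n : ℕ} (G : SimpleGraph (Fin n)) (β : Fin n → ℝ) :
    (∑ j, ∑ k, if G.Adj j k then 1 - lamE β j k else 0)
      = ∑ j, (degS G j : ℝ) - ∑ j, ∑ k, if G.Adj j k then lamE β j k else 0 := by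
  simp_rw [degS_eq_sum, ← Finset.sum_sub_distrib]
  refine Finset.sum_congr rfl fun j _ => Finset.sum_congr rfl fun k _ => ?_
  split_ifs <;> simp

/-- If `l` and the average `A` agree up to a factor `e^{2C}`, and `A` and `m` agree up to a
relative error `1 - e^{-C}`, then `l` and `m` agree up to a factor `e^{3C}`. -/
lemma exp_three_mul_bounds {C l A m : ℝ} (hm : 0 ≤ m)
    (h1 : l ≤ Real.exp (2 * C) * A) (h2 : A ≤ Real.exp (2 * C) * l)
    (h3 : |A - m| ≤ (1 - Real.exp (-C)) * m) :
    Real.exp (-3 * C) * m ≤ l ∧ l ≤ Real.exp (3 * C) * m := by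
  obtain ⟨h4, h5⟩ := abs_le.mp h3
  have e1 : Real.exp (3 * C) = Real.exp (2 * C) * Real.exp C := by
    rw [← Real.exp_add]; ring_nf
  have e2 : Real.exp (-3 * C) = Real.exp (-(2 * C)) * Real.exp (-C) := by
    rw [← Real.exp_add]; ring_nf
  have e3 : 2 - Real.exp (-C) ≤ Real.exp C := by
    linarith [Real.add_one_le_exp C, Real.add_one_le_exp (-C)]
  have e4 : Real.exp (-(2 * C)) * Real.exp (2 * C) = 1 := by
    rw [← Real.exp_add]; simp
  constructor
  · calc Real.exp (-3 * C) * m = Real.exp (-(2 * C)) * (Real.exp (-C) * m) := by rw [e2]; ring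
      _ ≤ Real.exp (-(2 * C)) * (Real.exp (2 * C) * l) :=
        mul_le_mul_of_nonneg_left (by linarith) (Real.exp_pos _).le
      _ = l := by rw [← mul_assoc, e4, one_mul]
  · calc l ≤ Real.exp (2 * C) * A := h1
      _ ≤ Real.exp (2 * C) * (Real.exp C * m) := by
        gcongr
        nlinarith [mul_le_mul_of_nonneg_right e3 hm]
      _ = Real.exp (3 * C) * m := by rw [e1]; ring

/-- For `ε < σ`, a constant multiple of `n ^ ε` is eventually below `n ^ σ`. -/
lemma exists_nat_mul_rpow_le (K : ℝ) {ε σv : ℝ} (h : ε < σv) :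
    ∃ n₀ : ℕ, ∀ n : ℕ, n₀ ≤ n → 0 < n ∧ K * (n : ℝ) ^ ε ≤ (n : ℝ) ^ σv := by
  have h1 : Filter.Tendsto (fun n : ℕ => (n : ℝ) ^ (σv - ε)) Filter.atTop Filter.atTop :=
    (tendsto_rpow_atTop (sub_pos.mpr h)).comp tendsto_natCast_atTop_atTop
  obtain ⟨n₀, hn₀⟩ := Filter.eventually_atTop.mp
    ((h1.eventually_ge_atTop K).and (Filter.eventually_gt_atTop 0))
  refine ⟨n₀, fun n hn => ⟨(hn₀ n hn).2, ?_⟩⟩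
  have hpos : (0 : ℝ) < n := Nat.cast_pos.mpr (hn₀ n hn).2
  calc K * (n : ℝ) ^ ε ≤ (n : ℝ) ^ (σv - ε) * (n : ℝ) ^ ε := by gcongr; exact (hn₀ n hn).1
    _ = (n : ℝ) ^ σv := by rw [← Real.rpow_add hpos]; ring_nf

/-- Under Assumptions (a)–(e), for every edge `jk` of `G`:
`e^{−3C}λ ≤ λ_{jk} ≤ e^{3C}λ`, `e^{−3C}(1−λ) ≤ 1−λ_{jk} ≤ e^{3C}(1−λ)`, and
`e^{−6C}Λ ≤ λ_{jk}(1−λ_{jk}) ≤ e^{6C}Λ`. -/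
theorem lambda_range (σv B C τQ cδ : ℝ)
    (hσ : 0 < σv) (hB : 0 < B) (hC : 0 < C) (hτ : 0 < τQ) (hcδ : 0 < cδ) :
    ∃ ε₀ : ℝ, 0 < ε₀ ∧ ∀ ε : ℝ, 0 < ε → ε ≤ ε₀ →
      ∃ n₀ : ℕ, ∀ n : ℕ, n₀ ≤ n →
        ∀ (G : SimpleGraph (Fin n)) (d : Fin n → ℕ) (β : Fin n → ℝ),
          (∀ j, 0 < d j) → Even (∑ j, d j) →
          Assumptions G d β σv B C τQ cδ ε →
          ∀ j k : Fin n, G.Adj j k →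
            Real.exp (-3 * C) * lamAvg G d ≤ lamE β j k ∧
            lamE β j k ≤ Real.exp (3 * C) * lamAvg G d ∧
            Real.exp (-3 * C) * (1 - lamAvg G d) ≤ 1 - lamE β j k ∧
            1 - lamE β j k ≤ Real.exp (3 * C) * (1 - lamAvg G d) ∧
            Real.exp (-6 * C) * LamV G d ≤ lamE β j k * (1 - lamE β j k) ∧
            lamE β j k * (1 - lamE β j k) ≤ Real.exp (6 * C) * LamV G d := by
  refine ⟨σv / 2, by positivity, fun ε hε hεσ => ?_⟩
  have hη : 0 < 1 - Real.exp (-C) := by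
    rw [sub_pos, Real.exp_lt_one_iff]
    linarith
  obtain ⟨n₀, hn₀⟩ := exists_nat_mul_rpow_le (2 * cδ / (τQ * B * (1 - Real.exp (-C))))
    (show ε < σv by linarith)
  refine ⟨n₀, fun n hn G d β _ _ hA j k hjk => ?_⟩
  obtain ⟨hdg, hβ, hΛ, -, hQ, -, hδ⟩ := hA
  obtain ⟨hnpos, hrpow⟩ := hn₀ n hn
  have hn0 : (0 : ℝ) < n := Nat.cast_pos.mpr hnpos
  set N : ℝ := ∑ j, (degS G j : ℝ) with hN
  set S : ℝ := ∑ j, ∑ k, if G.Adj j k then lamE β j k else 0 with hS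
  set D : ℝ := ∑ j, (d j : ℝ) with hD
  have hlam : lamAvg G d = D / N := rfl
  have hNlow : τQ * n * n ≤ 2 * N := hQ.mul_le_sum_degS
  have hNpos : 0 < N := by
    have : 0 < τQ * n * n := by positivity
    linarith
  have hD0 : 0 ≤ D := Finset.sum_nonneg fun _ _ => Nat.cast_nonneg _
  have hDN : D ≤ N := Finset.sum_le_sum fun i _ => Nat.cast_le.mpr (hdg i)
  have hl0 : 0 ≤ lamAvg G d := hlam ▸ div_nonneg hD0 hNpos.le
  have hl1 : lamAvg G d ≤ 1 := hlam ▸ (div_le_one hNpos).mpr hDN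
  have hSD : |S - D| ≤ cδ * (n : ℝ) ^ (1 + ε) := by
    rw [hS, hD, ← sum_deltaV]
    exact (Finset.abs_sum_le_sum_abs _ _).trans hδ
  have hclose : |S / N - lamAvg G d| ≤ (1 - Real.exp (-C)) * LamV G d := by
    rw [hlam, ← sub_div, abs_div, abs_of_pos hNpos, div_le_iff₀ hNpos]
    rw [div_mul_eq_mul_div, div_le_iff₀ (by positivity)] at hrpow
    have e1 : (n : ℝ) ^ (1 + ε) = n * (n : ℝ) ^ ε := by rw [Real.rpow_add hn0, Real.rpow_one]
    have e2 : (n : ℝ) ^ σv = n * (n : ℝ) ^ (σv - 1) := by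
      rw [Real.rpow_sub_one hn0.ne']
      field_simp
    have hp : 0 < (n : ℝ) ^ (σv - 1) := Real.rpow_pos_of_pos hn0 _
    calc |S - D| ≤ cδ * (n : ℝ) ^ (1 + ε) := hSD
      _ = n * (2 * cδ * (n : ℝ) ^ ε) / 2 := by rw [e1]; ring
      _ ≤ n * ((n : ℝ) ^ σv * (τQ * B * (1 - Real.exp (-C)))) / 2 := by gcongr
      _ = (1 - Real.exp (-C)) * (B * (n : ℝ) ^ (σv - 1)) * (τQ * n * n / 2) := by rw [e2]; ring
      _ ≤ (1 - Real.exp (-C)) * LamV G d * N := by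
        gcongr
        · exact mul_nonneg hη.le (le_trans (by positivity) hΛ)
        · linarith
  have hsum : ∀ a b, β j + β k ≤ β a + β b + 2 * C ∧ β a + β b ≤ β j + β k + 2 * C := by
    intro a b
    have h1 := abs_le.mp (hβ j a)
    have h2 := abs_le.mp (hβ k b)
    constructor <;> linarith
  have hC2 : 0 ≤ 2 * C := by positivity
  have b1 : lamE β j k * N ≤ Real.exp (2 * C) * S :=
    mul_sum_degS_le G _ _ _ fun a b _ => logistic_le_exp_mul hC2 (hsum a b).1
  have b2 : -(Real.exp (2 * C) * lamE β j k) * N ≤ -1 * S :=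
    mul_sum_degS_le G _ _ _ fun a b _ => by
      have := logistic_le_exp_mul hC2 (hsum a b).2
      simp only [lamE]
      linarith
  have b3 : (1 - lamE β j k) * N ≤ Real.exp (2 * C) * (N - S) := by
    rw [hN, hS, ← sum_one_sub_lamE]
    exact mul_sum_degS_le G _ _ _ fun a b _ => one_sub_logistic_le_exp_mul hC2 (hsum a b).2
  have b4 : -(Real.exp (2 * C) * (1 - lamE β j k)) * N ≤ -1 * (N - S) := by
    rw [hN, hS, ← sum_one_sub_lamE]
    exact mul_sum_degS_le G _ _ _ fun a b _ => by
      have := one_sub_logistic_le_exp_mul hC2 (hsum a b).1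
      simp only [lamE]
      linarith
  have hA1 : 1 - S / N = (N - S) / N := by field_simp
  obtain ⟨p1, p2⟩ := exp_three_mul_bounds (C := C) (l := lamE β j k) (A := S / N) hl0
    (by rw [← mul_div_assoc, le_div_iff₀ hNpos]; exact b1)
    (by rw [div_le_iff₀ hNpos]; linarith)
    (hclose.trans (mul_le_mul_of_nonneg_left (by rw [LamV]; nlinarith) hη.le))
  obtain ⟨p3, p4⟩ := exp_three_mul_bounds (C := C) (l := 1 - lamE β j k) (A := 1 - S / N)
    (sub_nonneg.mpr hl1)
    (by rw [hA1, ← mul_div_assoc, le_div_iff₀ hNpos]; exact b3)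
    (by rw [hA1, div_le_iff₀ hNpos]; linarith)
    (by
      rw [sub_sub_sub_cancel_left, abs_sub_comm]
      exact hclose.trans (mul_le_mul_of_nonneg_left (by rw [LamV]; nlinarith) hη.le))
  have hl1' : 0 ≤ 1 - lamAvg G d := sub_nonneg.mpr hl1
  have q0 : 0 ≤ lamE β j k := le_trans (by positivity) p1
  have q1 : 0 ≤ 1 - lamE β j k := le_trans (by positivity) p3
  refine ⟨p1, p2, p3, p4, ?_, ?_⟩
  · calc Real.exp (-6 * C) * LamV G d
        = (Real.exp (-3 * C) * lamAvg G d) * (Real.exp (-3 * C) * (1 - lamAvg G d)) := by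
          rw [LamV, show -6 * C = -3 * C + -3 * C by ring, Real.exp_add]; ring
      _ ≤ lamE β j k * (1 - lamE β j k) := by gcongr
  · calc lamE β j k * (1 - lamE β j k)
        ≤ (Real.exp (3 * C) * lamAvg G d) * (Real.exp (3 * C) * (1 - lamAvg G d)) := by gcongr
      _ = Real.exp (6 * C) * LamV G d := by
          rw [LamV, show 6 * C = 3 * C + 3 * C by ring, Real.exp_add]; ring

end
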